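/- Let A be a normal real n×n matrix (zero diagonal and all entries ≤ 0) with n ≥ 2. Then C_A = C_{A*}, where A* = A^{n-1} is the (n-1)-st tropical power of A (the Kleene star of A). -/

import Mathlib

open Finset

/-- Tropical (max-plus) product of square real matrices: (A⊙B) i j = max_k (A i k + B k j). -/
def tmul {n : ℕ} (A B : Matrix (Fin (n+1)) (Fin (n+1)) ℝ) :
    Matrix (Fin (n+1)) (Fin (n+1)) ℝ :=
  fun i j => univ.sup' univ_nonempty (fun k => A i k + B k j)

/-- Tropical column span of A: points x with x i = max_k (λ k + A i k) for some reals λ k. -/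
def tspan {n : ℕ} (A : Matrix (Fin (n+1)) (Fin (n+1)) ℝ) : Set (Fin (n+1) → ℝ) :=
  { x | ∃ lam : Fin (n+1) → ℝ,
      ∀ i, x i = univ.sup' univ_nonempty (fun k => lam k + A i k) }

/-- The alcoved polytope C_A induced by a (zero-diagonal) matrix A, viewed inside
the hyperplane {x : x (last) = 0}. -/
def CA {n : ℕ} (A : Matrix (Fin (n+1)) (Fin (n+1)) ℝ) : Set (Fin (n+1) → ℝ) :=
  { x | x (Fin.last n) = 0 ∧
      (∀ i, i ≠ Fin.last n → A i (Fin.last n) ≤ x i ∧ x i ≤ - A (Fin.last n) i) ∧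
      (∀ i k, i ≠ Fin.last n → k ≠ Fin.last n → i ≠ k →
        A i k ≤ x i - x k ∧ x i - x k ≤ - A k i) }

/-- Tropical power A^k (for k ≥ 1; `tpow A 0` is set to A by convention, unused). -/
def tpow {n : ℕ} (A : Matrix (Fin (n+1)) (Fin (n+1)) ℝ) :
    ℕ → Matrix (Fin (n+1)) (Fin (n+1)) ℝ
  | 0 => A
  | 1 => A
  | (k+2) => tmul A (tpow A (k+1))

theorem mem_CA_iff {n : ℕ} {A : Matrix (Fin (n+1)) (Fin (n+1)) ℝ} (hdiag : ∀ i, A i i ≤ 0)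
    {x : Fin (n+1) → ℝ} :
    x ∈ CA A ↔ x (Fin.last n) = 0 ∧ ∀ i j, A i j ≤ x i - x j := by
  constructor
  · rintro ⟨h0, h1, h2⟩
    refine ⟨h0, fun i j => ?_⟩
    by_cases hij : i = j
    · subst hij
      simpa using hdiag i
    by_cases hi : i = Fin.last n
    · subst hi
      linarith [(h1 j (Ne.symm hij)).2]
    by_cases hj : j = Fin.last n
    · subst hj
      linarith [(h1 i hi).1]
    exact (h2 i j hi hj hij).1
  · rintro ⟨h0, h⟩
    refine ⟨h0, fun i _ => ⟨?_, ?_⟩, fun i k _ _ _ => ⟨h i k, ?_⟩⟩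
    · linarith [h i (Fin.last n)]
    · linarith [h (Fin.last n) i]
    · linarith [h k i]

theorem tpow_le_sub {n : ℕ} {A : Matrix (Fin (n+1)) (Fin (n+1)) ℝ} {x : Fin (n+1) → ℝ}
    (h : ∀ i j, A i j ≤ x i - x j) (k : ℕ) (i j : Fin (n+1)) :
    tpow A (k+1) i j ≤ x i - x j := by
  induction k generalizing i j with
  | zero => exact h i j
  | succ k ih =>
    refine Finset.sup'_le univ_nonempty _ fun l _ => ?_
    linarith [h i l, ih l j]

theorem le_tpow {n : ℕ} {A : Matrix (Fin (n+1)) (Fin (n+1)) ℝ} (hdiag : ∀ i, A i i = 0)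
    (k : ℕ) (i j : Fin (n+1)) : A i j ≤ tpow A (k+1) i j := by
  induction k with
  | zero => exact le_rfl
  | succ k ih =>
    calc A i j ≤ A i i + tpow A (k+1) i j := by rw [hdiag, zero_add]; exact ih
      _ ≤ tpow A (k+1+1) i j :=
        Finset.le_sup' (fun l => A i l + tpow A (k+1) l j) (Finset.mem_univ i)

/-- For a normal matrix A of size m = n+2 (so m ≥ 2), C_A = C_{A*} where
A* = A^{m-1} is the Kleene star of A. -/
theorem CA_eq_CA_star (n : ℕ) (A : Matrix (Fin (n+2)) (Fin (n+2)) ℝ)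
    (hdiag : ∀ i, A i i = 0) (hneg : ∀ i j, A i j ≤ 0) :
    CA A = CA (tpow A (n+1)) := by
  have hpow : ∀ i, tpow A (n+1) i i ≤ 0 := fun i => by
    simpa using tpow_le_sub (x := fun _ => 0) (by simpa using hneg) n i i
  ext x
  rw [mem_CA_iff fun i => (hdiag i).le, mem_CA_iff hpow]
  exact and_congr_right fun _ =>
    ⟨fun h => tpow_le_sub h n, fun h i j => (le_tpow hdiag n i j).trans (h i j)⟩
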